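/- arXiv:2403.16283 — 7 statements merged into one kernel-verified Lean document; each statement's English description precedes it below -/
import Mathlib

section
/- Define the map (p₁, p₀) ↦ (q₁, q₀) by q₁ⱼ = p₁ⱼ τ̂ⱼ/τ̄ for j ∈ S₁ and q₀ⱼ = p₀ⱼ(1−τ̂ⱼ)/(1−τ̄) for j ∈ S₀. Then: (i) a positive weight vector (p₁, p₀) satisfies constraints (C1), (C2), and (C3) if and only if (q₁, q₀) satisfies constraints (C_q1); (ii) ℓ(q₁, q₀) = ℓ(p₁, p₀) + Σ_{j∈S₁} log(τ̂ⱼ/τ̄) + Σ_{j∈S₀} log((1−τ̂ⱼ)/(1−τ̄)), where the added term does not depend on (p₁, p₀); consequently (iii) (p₁, p₀) maximizes ℓ over the positive vectors satisfying (C1)–(C3) if and only if (q₁, q₀) maximizes ℓ over the positive vectors satisfying (C_q1). -/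
open scoped BigOperators

namespace SEL

/-- Two-sample SEL data: treated sample `S1`, control sample `S0`, estimated propensity
scores `tau`, fitted outcome values `m1, m0`, and observed outcomes `Y1, Y0`. -/
structure Setup (ι : Type*) where
  S1 : Finset ι
  S0 : Finset ι
  tau : ι → ℝ
  m1 : ι → ℝ
  m0 : ι → ℝ
  Y1 : ι → ℝ
  Y0 : ι → ℝ

variable {ι : Type*} [DecidableEq ι]

/-- Total sample size `n = n₁ + n₀`. -/
def Setup.n (E : Setup ι) : ℕ := E.S1.card + E.S0.card

/-- `τ̄ = n⁻¹ ∑_{j ∈ S} τ̂ⱼ`. -/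
noncomputable def Setup.taubar (E : Setup ι) : ℝ := (∑ j ∈ E.S1 ∪ E.S0, E.tau j) / E.n

/-- `m̄₁ = n⁻¹ ∑_{j ∈ S} m̂₁ⱼ`. -/
noncomputable def Setup.m1bar (E : Setup ι) : ℝ := (∑ j ∈ E.S1 ∪ E.S0, E.m1 j) / E.n

/-- `m̄₀ = n⁻¹ ∑_{j ∈ S} m̂₀ⱼ`. -/
noncomputable def Setup.m0bar (E : Setup ι) : ℝ := (∑ j ∈ E.S1 ∪ E.S0, E.m0 j) / E.n

/-- Positivity of a pair of weight vectors on the two samples. -/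
def Pos (E : Setup ι) (w1 w0 : ι → ℝ) : Prop :=
  (∀ j ∈ E.S1, 0 < w1 j) ∧ (∀ j ∈ E.S0, 0 < w0 j)

/-- The joint two-sample SEL objective `ℓ(w1, w0) = ∑_{S1} log w1ⱼ + ∑_{S0} log w0ⱼ`. -/
noncomputable def ell (E : Setup ι) (w1 w0 : ι → ℝ) : ℝ :=
  ∑ j ∈ E.S1, Real.log (w1 j) + ∑ j ∈ E.S0, Real.log (w0 j)

/-- Normalization constraints (C1). -/
def C1 (E : Setup ι) (p1 p0 : ι → ℝ) : Prop :=
  ∑ j ∈ E.S1, p1 j = 1 ∧ ∑ j ∈ E.S0, p0 j = 1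

/-- Model-calibration constraints (C2). -/
def C2 (E : Setup ι) (p1 p0 : ι → ℝ) : Prop :=
  ∑ j ∈ E.S1, p1 j * E.m1 j = E.m1bar ∧ ∑ j ∈ E.S0, p0 j * E.m0 j = E.m0bar

/-- Propensity score constraints (C3). -/
def C3 (E : Setup ι) (p1 p0 : ι → ℝ) : Prop :=
  ∑ j ∈ E.S1, p1 j * E.tau j = E.taubar ∧
  ∑ j ∈ E.S0, p0 j * (1 - E.tau j) = 1 - E.taubar

/-- Reformulated constraints (C_q1). -/
def Cq1 (E : Setup ι) (q1 q0 : ι → ℝ) : Prop :=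
  ∑ j ∈ E.S1, q1 j = 1 ∧ ∑ j ∈ E.S0, q0 j = 1 ∧
  ∑ j ∈ E.S1, q1 j * (E.tau j)⁻¹ * (E.tau j - E.taubar) = 0 ∧
  ∑ j ∈ E.S0, q0 j * (1 - E.tau j)⁻¹ * ((1 - E.tau j) - (1 - E.taubar)) = 0 ∧
  ∑ j ∈ E.S1, q1 j * (E.tau j)⁻¹ * (E.m1 j - E.m1bar) = 0 ∧
  ∑ j ∈ E.S0, q0 j * (1 - E.tau j)⁻¹ * (E.m0 j - E.m0bar) = 0

/-- Constraints on one sample: normalization, calibration of `m` and of `t` for weights `p`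
amount to three homogenized constraints for the weights `p * t / c`. -/
lemma constraints_iff {κ : Type*} (s : Finset κ) (t m p q : κ → ℝ) {c : ℝ} (b : ℝ)
    (hc : 0 < c) (ht : ∀ j ∈ s, 0 < t j) (hq : ∀ j ∈ s, q j = p j * t j / c) :
    (∑ j ∈ s, p j = 1 ∧ ∑ j ∈ s, p j * m j = b ∧ ∑ j ∈ s, p j * t j = c) ↔
      (∑ j ∈ s, q j = 1 ∧ ∑ j ∈ s, q j * (t j)⁻¹ * (t j - c) = 0 ∧
        ∑ j ∈ s, q j * (t j)⁻¹ * (m j - b) = 0) := by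
  have hdiv : ∀ j ∈ s, q j * (t j)⁻¹ = p j / c := fun j hj => by
    have := (ht j hj).ne'
    rw [hq j hj]
    field_simp
  have hsum : ∑ j ∈ s, q j = (∑ j ∈ s, p j * t j) / c := by
    rw [Finset.sum_div]
    exact Finset.sum_congr rfl hq
  have hcentred : ∀ (f : κ → ℝ) (a : ℝ), ∑ j ∈ s, q j * (t j)⁻¹ * (f j - a) =
      (∑ j ∈ s, p j * f j - (∑ j ∈ s, p j) * a) / c := fun f a => by
    rw [Finset.sum_mul, ← Finset.sum_sub_distrib, Finset.sum_div]
    refine Finset.sum_congr rfl fun j hj => ?_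
    rw [hdiv j hj]
    ring
  rw [hsum, hcentred, hcentred, div_eq_one_iff_eq hc.ne', div_eq_zero_iff, div_eq_zero_iff,
    or_iff_left hc.ne', or_iff_left hc.ne']
  constructor
  · rintro ⟨h1, hm, ht⟩
    simp [h1, hm, ht]
  · rintro ⟨ht, h1, hm⟩
    have hp : ∑ j ∈ s, p j = 1 :=
      mul_right_cancel₀ hc.ne' (by linarith)
    rw [hp] at hm
    exact ⟨hp, by linarith, ht⟩

lemma sum_log_rescale {κ : Type*} (s : Finset κ) (t p q : κ → ℝ) {c : ℝ} (hc : 0 < c)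
    (ht : ∀ j ∈ s, 0 < t j) (hp : ∀ j ∈ s, 0 < p j) (hq : ∀ j ∈ s, q j = p j * t j / c) :
    ∑ j ∈ s, Real.log (q j) = ∑ j ∈ s, Real.log (p j) + ∑ j ∈ s, Real.log (t j / c) := by
  rw [← Finset.sum_add_distrib]
  refine Finset.sum_congr rfl fun j hj => ?_
  rw [hq j hj, mul_div_assoc, Real.log_mul (hp j hj).ne' (div_pos (ht j hj) hc).ne']

/-- Reformulation of the constrained SEL maximization: the map
`q1ⱼ = p1ⱼ τ̂ⱼ/τ̄`, `q0ⱼ = p0ⱼ(1-τ̂ⱼ)/(1-τ̄)` turns the constraints (C1)-(C3) into (C_q1),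
shifts the SEL objective by a constant, and hence preserves maximizers. -/
theorem sel_reformulation {ι : Type*} [DecidableEq ι] (E : Setup ι)
    (hdisj : Disjoint E.S1 E.S0) (hS1 : E.S1.Nonempty) (hS0 : E.S0.Nonempty)
    (htau : ∀ j ∈ E.S1 ∪ E.S0, 0 < E.tau j ∧ E.tau j < 1)
    (htb0 : 0 < E.taubar) (htb1 : E.taubar < 1)
    (p1 p0 : ι → ℝ) (hpos : Pos E p1 p0)
    (q1 q0 : ι → ℝ)
    (hq1 : ∀ j ∈ E.S1, q1 j = p1 j * E.tau j / E.taubar)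
    (hq0 : ∀ j ∈ E.S0, q0 j = p0 j * (1 - E.tau j) / (1 - E.taubar)) :
    -- (i) equivalence of the constraint sets
    ((C1 E p1 p0 ∧ C2 E p1 p0 ∧ C3 E p1 p0) ↔ Cq1 E q1 q0) ∧
    -- (ii) the objective changes by a constant not depending on (p1, p0)
    (ell E q1 q0 = ell E p1 p0 +
      (∑ j ∈ E.S1, Real.log (E.tau j / E.taubar) +
        ∑ j ∈ E.S0, Real.log ((1 - E.tau j) / (1 - E.taubar)))) ∧
    -- (iii) equivalence of the two maximization problems
    (((C1 E p1 p0 ∧ C2 E p1 p0 ∧ C3 E p1 p0) ∧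
        ∀ p1' p0' : ι → ℝ, Pos E p1' p0' → (C1 E p1' p0' ∧ C2 E p1' p0' ∧ C3 E p1' p0') →
          ell E p1' p0' ≤ ell E p1 p0) ↔
      (Cq1 E q1 q0 ∧
        ∀ q1' q0' : ι → ℝ, Pos E q1' q0' → Cq1 E q1' q0' →
          ell E q1' q0' ≤ ell E q1 q0)) := by
  have ht1 : ∀ j ∈ E.S1, 0 < E.tau j := fun j hj =>
    (htau j (Finset.mem_union_left _ hj)).1
  have ht0 : ∀ j ∈ E.S0, 0 < 1 - E.tau j := fun j hj =>
    sub_pos.2 (htau j (Finset.mem_union_right _ hj)).2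
  have hc0 : 0 < 1 - E.taubar := sub_pos.2 htb1
  have hcon : ∀ p1 p0 q1 q0 : ι → ℝ, (∀ j ∈ E.S1, q1 j = p1 j * E.tau j / E.taubar) →
      (∀ j ∈ E.S0, q0 j = p0 j * (1 - E.tau j) / (1 - E.taubar)) →
      ((C1 E p1 p0 ∧ C2 E p1 p0 ∧ C3 E p1 p0) ↔ Cq1 E q1 q0) := by
    intro p1 p0 q1 q0 hq1 hq0
    have h1 := constraints_iff E.S1 E.tau E.m1 p1 q1 E.m1bar htb0 ht1 hq1
    have h0 := constraints_iff E.S0 (fun j => 1 - E.tau j) E.m0 p0 q0 E.m0bar hc0 ht0 hq0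
    unfold C1 C2 C3 Cq1
    tauto
  have hell : ∀ p1 p0 q1 q0 : ι → ℝ, Pos E p1 p0 →
      (∀ j ∈ E.S1, q1 j = p1 j * E.tau j / E.taubar) →
      (∀ j ∈ E.S0, q0 j = p0 j * (1 - E.tau j) / (1 - E.taubar)) →
      ell E q1 q0 = ell E p1 p0 + (∑ j ∈ E.S1, Real.log (E.tau j / E.taubar) +
        ∑ j ∈ E.S0, Real.log ((1 - E.tau j) / (1 - E.taubar))) := by
    intro p1 p0 q1 q0 hpos hq1 hq0
    have h1 := sum_log_rescale E.S1 E.tau p1 q1 htb0 ht1 hpos.1 hq1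
    have h0 := sum_log_rescale E.S0 (fun j => 1 - E.tau j) p0 q0 hc0 ht0 hpos.2 hq0
    unfold ell
    rw [h1, h0]
    ring
  refine ⟨hcon p1 p0 q1 q0 hq1 hq0, hell p1 p0 q1 q0 hpos hq1 hq0,
    and_congr (hcon p1 p0 q1 q0 hq1 hq0) ⟨fun h r1 r0 hr hCr => ?_, fun h r1 r0 hr hCr => ?_⟩⟩
  · let s1 : ι → ℝ := fun j => r1 j * E.taubar / E.tau j
    let s0 : ι → ℝ := fun j => r0 j * (1 - E.taubar) / (1 - E.tau j)
    have hs : Pos E s1 s0 :=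
      ⟨fun j hj => div_pos (mul_pos (hr.1 j hj) htb0) (ht1 j hj),
        fun j hj => div_pos (mul_pos (hr.2 j hj) hc0) (ht0 j hj)⟩
    have hr1 : ∀ j ∈ E.S1, r1 j = s1 j * E.tau j / E.taubar := fun j hj => by
      rw [div_mul_cancel₀ _ (ht1 j hj).ne', mul_div_cancel_right₀ _ htb0.ne']
    have hr0 : ∀ j ∈ E.S0, r0 j = s0 j * (1 - E.tau j) / (1 - E.taubar) := fun j hj => by
      rw [div_mul_cancel₀ _ (ht0 j hj).ne', mul_div_cancel_right₀ _ hc0.ne']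
    have := h s1 s0 hs ((hcon s1 s0 r1 r0 hr1 hr0).2 hCr)
    rw [hell s1 s0 r1 r0 hs hr1 hr0, hell p1 p0 q1 q0 hpos hq1 hq0]
    gcongr
  · have := h (fun j => r1 j * E.tau j / E.taubar)
      (fun j => r0 j * (1 - E.tau j) / (1 - E.taubar))
      ⟨fun j hj => div_pos (mul_pos (hr.1 j hj) (ht1 j hj)) htb0,
        fun j hj => div_pos (mul_pos (hr.2 j hj) (ht0 j hj)) hc0⟩
      ((hcon r1 r0 _ _ (fun _ _ => rfl) fun _ _ => rfl).1 hCr)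
    rw [hell r1 r0 _ _ hr (fun _ _ => rfl) fun _ _ => rfl,
      hell p1 p0 q1 q0 hpos hq1 hq0] at this
    exact le_of_add_le_add_right this

end SEL
end

section
/- (Lemma 1.) Let (q̂₁, q̂₀) be a maximizer of ℓ over the positive weight vectors satisfying (C_q1). Define μ̂₁ = τ̄ Σ_{j∈S₁} q̂₁ⱼ Y₁ⱼ/τ̂ⱼ, μ̂₀ = (1−τ̄) Σ_{j∈S₀} q̂₀ⱼ Y₀ⱼ/(1−τ̂ⱼ), and θ̂ = μ̂₁ − μ̂₀. Then: (i) (q̂₁, q̂₀) satisfies the parameter constraints (C_q2) at (μ̂₁, θ̂); (ii) the profile value P(μ̂₁, θ̂) equals ℓ(q̂₁, q̂₀); and (iii) P(μ₁, θ) ≤ P(μ̂₁, θ̂) for every (μ₁, θ) ∈ ℝ², i.e., the maximum SEL estimators (μ̂₁, θ̂) maximize the profile sample empirical likelihood function. -/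
open scoped BigOperators

namespace SEL

variable {ι : Type*} [DecidableEq ι]

/-- Parameter constraints (C_q2) at `(μ₁, θ)`. -/
def Cq2 (E : Setup ι) (q1 q0 : ι → ℝ) (mu1 θ : ℝ) : Prop :=
  ∑ j ∈ E.S1, q1 j * (E.tau j)⁻¹ * (E.Y1 j - mu1) = 0 ∧
  ∑ j ∈ E.S0, q0 j * (1 - E.tau j)⁻¹ * (E.Y0 j - mu1 + θ) = 0

/-- The profile SEL function `P(μ₁, θ)`: the supremum (in `ℝ ∪ {-∞}`, realized as `EReal`)
of the SEL objective over positive weights satisfying (C_q1) and (C_q2) at `(μ₁, θ)`. -/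
noncomputable def Pfun [DecidableEq ι] (E : Setup ι) (mu1 θ : ℝ) : EReal :=
  sSup {x : EReal | ∃ q1 q0 : ι → ℝ, Pos E q1 q0 ∧ Cq1 E q1 q0 ∧ Cq2 E q1 q0 mu1 θ ∧
    x = (ell E q1 q0 : EReal)}

/-- If normalized weights `w` satisfy the calibration constraint `∑ w t⁻¹ (t - b) = 0`, then
`b * ∑ w Y / t` solves the inverse-weighted estimating equation for the mean of `Y`. -/
theorem sum_mul_inv_mul_sub_eq_zero {ι : Type*} {s : Finset ι} {w t Y : ι → ℝ} {b : ℝ}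
    (ht : ∀ j ∈ s, t j ≠ 0) (hw : ∑ j ∈ s, w j = 1)
    (hb : ∑ j ∈ s, w j * (t j)⁻¹ * (t j - b) = 0) :
    ∑ j ∈ s, w j * (t j)⁻¹ * (Y j - b * ∑ i ∈ s, w i * Y i / t i) = 0 := by
  have hinv : b * ∑ j ∈ s, w j * (t j)⁻¹ = 1 := by
    have h : ∑ j ∈ s, w j * (t j)⁻¹ * (t j - b) = ∑ j ∈ s, (w j - b * (w j * (t j)⁻¹)) :=
      Finset.sum_congr rfl fun j hj => by
        have := ht j hj
        field_simp
    rw [h, Finset.sum_sub_distrib, ← Finset.mul_sum, hw] at hb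
    linarith
  have hY : ∑ j ∈ s, w j * (t j)⁻¹ * Y j = ∑ j ∈ s, w j * Y j / t j :=
    Finset.sum_congr rfl fun j _ => by ring
  simp only [mul_sub, Finset.sum_sub_distrib, ← Finset.sum_mul]
  rw [hY]
  linear_combination (-∑ j ∈ s, w j * Y j / t j) * hinv

/-- The profile value never exceeds an upper bound of the objective under (C_q1). -/
theorem Pfun_le {ι : Type*} [DecidableEq ι] {E : Setup ι} {c : ℝ}
    (hc : ∀ q1 q0 : ι → ℝ, Pos E q1 q0 → Cq1 E q1 q0 → ell E q1 q0 ≤ c) (mu1 θ : ℝ) :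
    Pfun E mu1 θ ≤ (c : EReal) := by
  refine sSup_le ?_
  rintro x ⟨q1, q0, hp, hq, -, rfl⟩
  exact EReal.coe_le_coe_iff.2 (hc q1 q0 hp hq)

/-- Lemma 1: if `(q̂1, q̂0)` maximizes the SEL objective under (C_q1), then the maximum SEL
estimators `μ̂₁, θ̂` satisfy (C_q2), the profile value at `(μ̂₁, θ̂)` equals `ℓ(q̂1, q̂0)`, and
`(μ̂₁, θ̂)` maximizes the profile SEL function. -/
theorem sel_lemma1 {ι : Type*} [DecidableEq ι] (E : Setup ι)
    (hdisj : Disjoint E.S1 E.S0) (hS1 : E.S1.Nonempty) (hS0 : E.S0.Nonempty)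
    (htau : ∀ j ∈ E.S1 ∪ E.S0, 0 < E.tau j ∧ E.tau j < 1)
    (htb0 : 0 < E.taubar) (htb1 : E.taubar < 1)
    (q1 q0 : ι → ℝ) (hpos : Pos E q1 q0) (hfeas : Cq1 E q1 q0)
    (hmax : ∀ q1' q0' : ι → ℝ, Pos E q1' q0' → Cq1 E q1' q0' →
      ell E q1' q0' ≤ ell E q1 q0)
    (mu1hat mu0hat thetahat : ℝ)
    (hmu1 : mu1hat = E.taubar * ∑ j ∈ E.S1, q1 j * E.Y1 j / E.tau j)
    (hmu0 : mu0hat = (1 - E.taubar) * ∑ j ∈ E.S0, q0 j * E.Y0 j / (1 - E.tau j))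
    (hth : thetahat = mu1hat - mu0hat) :
    Cq2 E q1 q0 mu1hat thetahat ∧
    Pfun E mu1hat thetahat = (ell E q1 q0 : EReal) ∧
    ∀ mu1 θ : ℝ, Pfun E mu1 θ ≤ Pfun E mu1hat thetahat := by
  have hC : Cq2 E q1 q0 mu1hat thetahat := by
    obtain ⟨h1, h0, ht1, ht0, -, -⟩ := hfeas
    refine ⟨?_, ?_⟩
    · rw [hmu1]
      exact sum_mul_inv_mul_sub_eq_zero
        (fun j hj => (htau j (Finset.mem_union_left _ hj)).1.ne') h1 ht1
    · have h := sum_mul_inv_mul_sub_eq_zero (t := fun j => 1 - E.tau j) (Y := E.Y0)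
        (fun j hj => (sub_pos.2 (htau j (Finset.mem_union_right _ hj)).2).ne') h0 ht0
      rw [← hmu0] at h
      rw [← h, hth]
      exact Finset.sum_congr rfl fun j _ => by ring
  have hP : Pfun E mu1hat thetahat = (ell E q1 q0 : EReal) :=
    le_antisymm (Pfun_le hmax _ _) (le_sSup ⟨q1, q0, hpos, hfeas, hC, rfl⟩)
  exact ⟨hC, hP, fun mu1 θ => hP ▸ Pfun_le hmax mu1 θ⟩

end SEL
end

section
/- (Lemma 3.) Let (p̂₁, p̂₀) be a maximizer of ℓ over the positive weight vectors satisfying (C_SEL2). Define μ̂₁ = (Σ_{S₁} p̂₁ⱼ Y₁ⱼ/τ̂ⱼ)/(Σ_{S₁} p̂₁ⱼ/τ̂ⱼ), μ̂₀ = (Σ_{S₀} p̂₀ⱼ Y₀ⱼ/(1−τ̂ⱼ))/(Σ_{S₀} p̂₀ⱼ/(1−τ̂ⱼ)), and θ̂ = μ̂₁ − μ̂₀. Then: (i) (p̂₁, p̂₀) satisfies the weighted parameter constraints at (μ̂₁, θ̂); (ii) the profile value P₂(μ̂₁, θ̂) equals ℓ(p̂₁, p̂₀); and (iii) P₂(μ₁,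 θ) ≤ P₂(μ̂₁, θ̂) for every (μ₁, θ) ∈ ℝ², i.e., the maximum SEL estimators (μ̂₁, θ̂) maximize the profile sample empirical likelihood function of the second SEL approach. -/
open scoped BigOperators

namespace SEL

variable {ι : Type*} [DecidableEq ι]

/-- Constraints (C_SEL2): normalization and propensity-score-weighted model calibration. -/
def CSEL2 (E : Setup ι) (p1 p0 : ι → ℝ) : Prop :=
  ∑ j ∈ E.S1, p1 j = 1 ∧ ∑ j ∈ E.S0, p0 j = 1 ∧
  ∑ j ∈ E.S1, p1 j * (E.tau j)⁻¹ * (E.m1 j - E.m1bar) = 0 ∧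
  ∑ j ∈ E.S0, p0 j * (1 - E.tau j)⁻¹ * (E.m0 j - E.m0bar) = 0

/-- Weighted parameter constraints at `(μ₁, θ)`. -/
def WPar (E : Setup ι) (p1 p0 : ι → ℝ) (mu1 θ : ℝ) : Prop :=
  ∑ j ∈ E.S1, p1 j * (E.tau j)⁻¹ * (E.Y1 j - mu1) = 0 ∧
  ∑ j ∈ E.S0, p0 j * (1 - E.tau j)⁻¹ * (E.Y0 j - mu1 + θ) = 0

/-- The profile SEL function `P₂(μ₁, θ)` of the second SEL approach: the supremum (in
`ℝ ∪ {-∞}`, realized as `EReal`) of the SEL objective over positive weights satisfying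
(C_SEL2) and the weighted parameter constraints at `(μ₁, θ)`. -/
noncomputable def P2fun [DecidableEq ι] (E : Setup ι) (mu1 θ : ℝ) : EReal :=
  sSup {x : EReal | ∃ p1 p0 : ι → ℝ, Pos E p1 p0 ∧ CSEL2 E p1 p0 ∧ WPar E p1 p0 mu1 θ ∧
    x = (ell E p1 p0 : EReal)}

theorem sum_weighted_sub_mean_eq_zero {ι : Type*} {s : Finset ι} (p t y : ι → ℝ)
    (h : ∑ j ∈ s, p j / t j ≠ 0) :
    ∑ j ∈ s, p j * (t j)⁻¹ *
      (y j - (∑ k ∈ s, p k * y k / t k) / ∑ k ∈ s, p k / t k) = 0 := by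
  have h1 : ∀ c : ℝ, ∑ j ∈ s, p j * (t j)⁻¹ * (y j - c) =
      ∑ j ∈ s, p j * y j / t j - (∑ j ∈ s, p j / t j) * c := by
    intro c
    rw [Finset.sum_mul, ← Finset.sum_sub_distrib]
    exact Finset.sum_congr rfl fun j _ => by ring
  rw [h1, mul_div_cancel₀ _ h, sub_self]

theorem P2fun_le_of_isMax {ι : Type*} [DecidableEq ι] (E : Setup ι) {p1 p0 : ι → ℝ}
    (hmax : ∀ p1' p0' : ι → ℝ, Pos E p1' p0' → CSEL2 E p1' p0' →
      ell E p1' p0' ≤ ell E p1 p0) (mu1 θ : ℝ) :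
    P2fun E mu1 θ ≤ (ell E p1 p0 : EReal) := by
  refine sSup_le ?_
  rintro x ⟨q1, q0, hq, hc, -, rfl⟩
  exact EReal.coe_le_coe (hmax q1 q0 hq hc)

/-- Lemma 3: if `(p̂1, p̂0)` maximizes the SEL objective under (C_SEL2), then the maximum SEL
estimators `μ̂₁, θ̂` satisfy the weighted parameter constraints, the profile value at
`(μ̂₁, θ̂)` equals `ℓ(p̂1, p̂0)`, and `(μ̂₁, θ̂)` maximizes the profile SEL function. -/
theorem sel_lemma3 {ι : Type*} [DecidableEq ι] (E : Setup ι)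
    (hdisj : Disjoint E.S1 E.S0) (hS1 : E.S1.Nonempty) (hS0 : E.S0.Nonempty)
    (htau : ∀ j ∈ E.S1 ∪ E.S0, 0 < E.tau j ∧ E.tau j < 1)
    (p1 p0 : ι → ℝ) (hpos : Pos E p1 p0) (hfeas : CSEL2 E p1 p0)
    (hmax : ∀ p1' p0' : ι → ℝ, Pos E p1' p0' → CSEL2 E p1' p0' →
      ell E p1' p0' ≤ ell E p1 p0)
    (mu1hat mu0hat thetahat : ℝ)
    (hmu1 : mu1hat = (∑ j ∈ E.S1, p1 j * E.Y1 j / E.tau j) /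
      (∑ j ∈ E.S1, p1 j / E.tau j))
    (hmu0 : mu0hat = (∑ j ∈ E.S0, p0 j * E.Y0 j / (1 - E.tau j)) /
      (∑ j ∈ E.S0, p0 j / (1 - E.tau j)))
    (hth : thetahat = mu1hat - mu0hat) :
    WPar E p1 p0 mu1hat thetahat ∧
    P2fun E mu1hat thetahat = (ell E p1 p0 : EReal) ∧
    ∀ mu1 θ : ℝ, P2fun E mu1 θ ≤ P2fun E mu1hat thetahat := by
  have hw : WPar E p1 p0 mu1hat thetahat := by
    refine ⟨?_, ?_⟩
    · rw [hmu1]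
      refine sum_weighted_sub_mean_eq_zero p1 E.tau E.Y1 (Finset.sum_pos ?_ hS1).ne'
      exact fun j hj => div_pos (hpos.1 j hj) (htau j (Finset.mem_union_left _ hj)).1
    · have h := sum_weighted_sub_mean_eq_zero p0 (fun j => 1 - E.tau j) E.Y0
        (Finset.sum_pos (fun j hj => div_pos (hpos.2 j hj)
          (sub_pos.2 (htau j (Finset.mem_union_right _ hj)).2)) hS0).ne'
      rw [← hmu0] at h
      rw [← h, hth]
      exact Finset.sum_congr rfl fun j _ => by ring
  have heq : P2fun E mu1hat thetahat = (ell E p1 p0 : EReal) :=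
    le_antisymm (P2fun_le_of_isMax E hmax _ _) (le_sSup ⟨p1, p0, hpos, hfeas, hw, rfl⟩)
  exact ⟨hw, heq, fun mu1 θ => heq ▸ P2fun_le_of_isMax E hmax mu1 θ⟩

end SEL
end

section
/- Let S be an m×m real symmetric positive definite matrix, let U be an m×2 real matrix of rank 2, and let u ∈ ℝ^m be the first column of U. Then UᵀS⁻¹U is invertible, uᵀS⁻¹u ≠ 0, and the matrix D = S⁻¹U(UᵀS⁻¹U)⁻¹UᵀS⁻¹ − S⁻¹u(uᵀS⁻¹u)⁻¹uᵀS⁻¹ is symmetric, positive semidefinite, and has rank exactly one. -/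
open Matrix

namespace Matrix

theorem mulVec_injective_of_rank_eq_card {m n K : Type*} [Field K] [Finite m] [Fintype n]
    {A : Matrix m n K} (hA : A.rank = Fintype.card n) : Function.Injective A.mulVec := by
  rw [mulVec_injective_iff, linearIndependent_iff_card_eq_finrank_span, Set.finrank,
    ← rank_eq_finrank_span_cols, hA]

theorem rank_vecMulVec_of_ne_zero {m n K : Type*} [Field K] [Finite m] [Fintype n]
    {v : m → K} {w : n → K} (hv : v ≠ 0) (hw : w ≠ 0) : (vecMulVec v w).rank = 1 := by
  refine le_antisymm (rank_vecMulVec_le v w) (Nat.one_le_iff_ne_zero.mpr fun h => ?_)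
  rw [rank, Submodule.finrank_eq_zero, LinearMap.range_eq_bot] at h
  obtain ⟨j, hj⟩ := Function.ne_iff.mp hw
  classical
  obtain ⟨i, hi⟩ := Function.ne_iff.mp hv
  have hij : v i * w j = 0 := by
    simpa only [mulVecLin_apply, mulVec_single_one, col_apply, vecMulVec_apply,
      LinearMap.zero_apply, Pi.zero_apply] using
      congrFun (LinearMap.congr_fun h (Pi.single j 1)) i
  exact mul_ne_zero hi hj hij

/-- For a positive definite `2 × 2` matrix, the inverse minus the inverse of the leading
`1 × 1` block is the outer product of a nonzero vector with itself. -/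
theorem PosDef.exists_inv_sub_eq_vecMulVec {G : Matrix (Fin 2) (Fin 2) ℝ} (hG : G.PosDef) :
    ∃ q : Fin 2 → ℝ, q ≠ 0 ∧
      G⁻¹ - vecMulVec (Pi.single 0 (G 0 0)⁻¹) (Pi.single 0 1) = vecMulVec q q := by
  have ha : 0 < G 0 0 := hG.diag_pos
  have hd : 0 < G.det := hG.det_pos
  have hsymm : G 1 0 = G 0 1 := by simpa using hG.isHermitian.apply 0 1
  have hr : 0 < G 0 0 * G.det := mul_pos ha hd
  have hsq : √(G 0 0 * G.det) ^ 2 = G 0 0 * G.det := Real.sq_sqrt hr.le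
  have hs : √(G 0 0 * G.det) ≠ 0 := (Real.sqrt_pos.mpr hr).ne'
  refine ⟨(√(G 0 0 * G.det))⁻¹ • ![-G 0 1, G 0 0], fun h => ?_, ?_⟩
  · simpa [hs, ha.ne'] using congrFun h 1
  · rw [smul_vecMulVec, vecMulVec_smul, smul_smul, ← sq, inv_pow, hsq, inv_def,
      adjugate_fin_two, Ring.inverse_eq_inv']
    have hdet := G.det_fin_two
    rw [hsymm] at hdet
    ext i j
    fin_cases i <;> fin_cases j <;> simp [vecMulVec_apply, hsymm] <;> field_simp
    linear_combination -hdet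

end Matrix

/-- If `S` is an `m × m` real symmetric positive definite matrix, `U` is an `m × 2` matrix
of rank 2, and `u` is the first column of `U`, then `UᵀS⁻¹U` is invertible, `uᵀS⁻¹u ≠ 0`,
and `D = S⁻¹U(UᵀS⁻¹U)⁻¹UᵀS⁻¹ - S⁻¹u(uᵀS⁻¹u)⁻¹uᵀS⁻¹` is symmetric, positive semidefinite,
and has rank exactly one. -/
theorem projection_difference_rank_one {m : ℕ}
    (S : Matrix (Fin m) (Fin m) ℝ) (hS : S.PosDef)
    (U : Matrix (Fin m) (Fin 2) ℝ) (hU : U.rank = 2)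
    (u : Matrix (Fin m) (Fin 1) ℝ) (hu : ∀ i, u i 0 = U i 0)
    (D : Matrix (Fin m) (Fin m) ℝ)
    (hD : D = S⁻¹ * U * (Uᵀ * S⁻¹ * U)⁻¹ * Uᵀ * S⁻¹
            - S⁻¹ * u * (uᵀ * S⁻¹ * u)⁻¹ * uᵀ * S⁻¹) :
    IsUnit (Uᵀ * S⁻¹ * U) ∧
    uᵀ * S⁻¹ * u ≠ 0 ∧
    Dᵀ = D ∧ D.PosSemidef ∧ D.rank = 1 := by
  have hU_inj : Function.Injective U.mulVec := mulVec_injective_of_rank_eq_card (by simpa using hU)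
  have hG : (Uᵀ * S⁻¹ * U).PosDef := by
    simpa using hS.inv.conjTranspose_mul_mul_same hU_inj
  have hS_symm : S⁻¹ᵀ = S⁻¹ := by simpa using hS.inv.isHermitian.eq
  have hu_block : uᵀ * S⁻¹ * u = of fun _ _ => (Uᵀ * S⁻¹ * U) 0 0 := by
    ext i j
    fin_cases i; fin_cases j
    simp [mul_apply, hu]
  obtain ⟨q, hq, hGq⟩ := hG.exists_inv_sub_eq_vecMulVec
  have hu_proj : u * (uᵀ * S⁻¹ * u)⁻¹ * uᵀ =
      U * vecMulVec (Pi.single (0 : Fin 2) ((Uᵀ * S⁻¹ * U) 0 0)⁻¹)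
        (Pi.single (0 : Fin 2) 1) * Uᵀ := by
    rw [hu_block, mul_vecMulVec, vecMulVec_mul, vecMul_transpose]
    generalize (Uᵀ * S⁻¹ * U) 0 0 = a
    ext i j
    simp [mul_apply, vecMulVec_apply, hu, Ring.inverse_eq_inv', mul_comm]
  have hDq : D = vecMulVec ((S⁻¹ * U) *ᵥ q) ((S⁻¹ * U) *ᵥ q) := by
    have hfactor : D = S⁻¹ * U * vecMulVec q q * (S⁻¹ * U)ᵀ := by
      rw [← hGq, transpose_mul, hS_symm, Matrix.mul_sub, Matrix.sub_mul, hD]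
      simp only [Matrix.mul_assoc] at hu_proj ⊢
      congr 1
      simp only [← Matrix.mul_assoc] at hu_proj ⊢
      simpa only [← Matrix.mul_assoc] using congrArg (fun X => S⁻¹ * X * S⁻¹) hu_proj
    rw [hfactor, mul_vecMulVec, vecMulVec_mul, vecMul_transpose]
  have hn : (S⁻¹ * U) *ᵥ q ≠ 0 := by
    rw [← mulVec_mulVec]
    intro h
    refine hq (hU_inj (mulVec_injective_of_isUnit hS.inv.isUnit ?_))
    simpa using h
  refine ⟨hG.isUnit, fun h => ?_, ?_, ?_, ?_⟩
  · rw [hu_block] at h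
    exact hG.diag_pos.ne' (congrFun₂ h 0 0)
  · rw [hDq, transpose_vecMulVec]
  · rw [hDq]
    simpa using posSemidef_vecMulVec_self_star ((S⁻¹ * U) *ᵥ q)
  · rw [hDq]
    exact rank_vecMulVec_of_ne_zero hn hn
end

section
/- Under the SITA assumption that T and Y₁ are conditionally independent given σ(X), with τ a σ(X)-measurable version of E[T | σ(X)] satisfying c₁ ≤ τ ≤ c₂ almost surely for constants 0 < c₁ ≤ c₂ < 1, the random variable T·Y₁/τ is integrable and E[T·Y₁/τ] = E[Y₁]. (This is the inverse probability weighting identity underlying the IPW estimator of μ₁.) -/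
open MeasureTheory ProbabilityTheory

namespace ProbabilityTheory

variable {Ω : Type*} {m mΩ : MeasurableSpace Ω} [StandardBorelSpace Ω] {hm : m ≤ mΩ}
  {μ : Measure Ω} [IsFiniteMeasure μ]

/-- Conditionally independent measurable functions are almost surely independent under the
regular conditional distribution. -/
lemma CondIndepFun.ae_indepFun_condExpKernel {β γ : Type*} {mβ : MeasurableSpace β}
    {mγ : MeasurableSpace γ} [MeasurableSpace.CountablyGenerated (β × γ)] {f : Ω → β} {g : Ω → γ}
    (h : CondIndepFun m hm f g μ) (hf : Measurable f) (hg : Measurable g) :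
    ∀ᵐ ω ∂μ, IndepFun f g (condExpKernel μ m ω) := by
  filter_upwards [ae_of_ae_trim hm ((condIndepFun_iff_map_prod_eq_prod_map_map hf hg).1 h)]
    with ω hω
  rw [indepFun_iff_map_prod_eq_prod_map_map hf.aemeasurable hg.aemeasurable]
  rwa [Kernel.map_apply _ (hf.prodMk hg), Kernel.prod_apply, Kernel.map_apply _ hf,
    Kernel.map_apply _ hg] at hω

/-- The conditional expectation of a product of conditionally independent integrable random
variables is the product of their conditional expectations. -/
lemma CondIndepFun.condExp_mul {f g : Ω → ℝ} (h : CondIndepFun m hm f g μ)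
    (hf : Integrable f μ) (hg : Integrable g μ) (hfg : Integrable (f * g) μ) :
    μ[f * g | m] =ᵐ[μ] μ[f | m] * μ[g | m] := by
  have hf_mk := hf.aemeasurable.ae_eq_mk
  have hg_mk := hg.aemeasurable.ae_eq_mk
  have ae_kernel {p : Ω → Prop} (hp : ∀ᵐ ω ∂μ, p ω) :
      ∀ᵐ ω ∂μ.trim hm, ∀ᵐ ω' ∂condExpKernel μ m ω, p ω' :=
    Measure.ae_ae_of_ae_comp (by rwa [condExpKernel_comp_trim])
  have h_mk : CondIndepFun m hm (hf.aemeasurable.mk f) (hg.aemeasurable.mk g) μ :=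
    Kernel.IndepFun.congr' h (ae_kernel hf_mk) (ae_kernel hg_mk)
  filter_upwards [condExp_ae_eq_integral_condExpKernel hm hfg,
    condExp_ae_eq_integral_condExpKernel hm hf, condExp_ae_eq_integral_condExpKernel hm hg,
    h_mk.ae_indepFun_condExpKernel hf.aemeasurable.measurable_mk hg.aemeasurable.measurable_mk,
    ae_of_ae_trim hm (ae_kernel hf_mk), ae_of_ae_trim hm (ae_kernel hg_mk)]
    with ω h_mul h_left h_right h_indep hf_ae hg_ae
  rw [Pi.mul_apply, h_mul, h_left, h_right]
  exact (h_indep.congr (Filter.EventuallyEq.symm hf_ae)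
    (Filter.EventuallyEq.symm hg_ae)).integral_mul_eq_mul_integral
    (hf.aemeasurable.measurable_mk.aestronglyMeasurable.congr (Filter.EventuallyEq.symm hf_ae))
    (hg.aemeasurable.measurable_mk.aestronglyMeasurable.congr (Filter.EventuallyEq.symm hg_ae))

end ProbabilityTheory

/-- Inverse probability weighting identity: under SITA (`T` and `Y₁` conditionally
independent given `σ(X)`), with `τ` a `σ(X)`-measurable version of `E[T | σ(X)]` bounded
in `[c₁, c₂] ⊆ (0, 1)`, the random variable `T·Y₁/τ` is integrable and
`E[T·Y₁/τ] = E[Y₁]`. -/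
theorem ipw_identity_treated {Ω : Type*} [mΩ : MeasurableSpace Ω]
    [StandardBorelSpace Ω] [Nonempty Ω]
    {E : Type*} [mE : MeasurableSpace E]
    (μ : Measure Ω) [IsProbabilityMeasure μ]
    (X : Ω → E) (hX : Measurable X)
    (T : Ω → ℝ) (hTmeas : Measurable T) (hT01 : ∀ ω, T ω = 0 ∨ T ω = 1)
    (Y1 : Ω → ℝ) (hY1 : Integrable Y1 μ)
    (hCI : CondIndepFun (mE.comap X) hX.comap_le T Y1 μ)
    (τ : Ω → ℝ) (hτmeas : Measurable[mE.comap X] τ)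
    (hτver : τ =ᵐ[μ] μ[T | mE.comap X])
    (c₁ c₂ : ℝ) (hc₁ : 0 < c₁) (hc₁₂ : c₁ ≤ c₂) (hc₂ : c₂ < 1)
    (hτbd : ∀ᵐ ω ∂μ, c₁ ≤ τ ω ∧ τ ω ≤ c₂) :
    Integrable (fun ω => T ω * Y1 ω / τ ω) μ ∧
    ∫ ω, T ω * Y1 ω / τ ω ∂μ = ∫ ω, Y1 ω ∂μ := by
  have hm : mE.comap X ≤ mΩ := hX.comap_le
  have hT_norm (ω : Ω) : ‖T ω‖ ≤ 1 := by rcases hT01 ω with h | h <;> simp [h]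
  have hT : Integrable T μ :=
    .of_bound hTmeas.aestronglyMeasurable 1 (ae_of_all _ hT_norm)
  have hTY : Integrable (T * Y1) μ :=
    hY1.bdd_mul hTmeas.aestronglyMeasurable (ae_of_all _ hT_norm)
  have hτ_inv : StronglyMeasurable[mE.comap X] τ⁻¹ := hτmeas.inv.stronglyMeasurable
  have hτ_inv_norm : ∀ᵐ ω ∂μ, ‖τ⁻¹ ω‖ ≤ c₁⁻¹ := by
    filter_upwards [hτbd] with ω hω
    rw [Pi.inv_apply, norm_inv, Real.norm_of_nonneg (hc₁.le.trans hω.1)]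
    exact inv_anti₀ hc₁ hω.1
  have h_eq : (fun ω => T ω * Y1 ω / τ ω) = τ⁻¹ * (T * Y1) := by
    ext ω
    simp [div_eq_inv_mul]
  have h_int : Integrable (τ⁻¹ * (T * Y1)) μ :=
    hTY.bdd_mul (hτ_inv.mono hm).aestronglyMeasurable hτ_inv_norm
  have h_condExp : μ[τ⁻¹ * (T * Y1) | mE.comap X] =ᵐ[μ] μ[Y1 | mE.comap X] := by
    filter_upwards [condExp_mul_of_stronglyMeasurable_left hτ_inv h_int hTY,
      hCI.condExp_mul hT hY1 hTY, hτver, hτbd] with ω h_pull h_mul h_ver h_bd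
    have hτ_ne : τ ω ≠ 0 := (hc₁.trans_le h_bd.1).ne'
    rw [h_pull, Pi.mul_apply, h_mul, Pi.mul_apply, ← h_ver, Pi.inv_apply,
      inv_mul_cancel_left₀ hτ_ne]
  rw [h_eq]
  exact ⟨h_int, by rw [← integral_condExp hm, integral_congr_ae h_condExp, integral_condExp hm]⟩
end

section
/- Under the SITA assumption that T and Y₀ are conditionally independent given σ(X), with τ a σ(X)-measurable version of E[T | σ(X)] satisfying c₁ ≤ τ ≤ c₂ almost surely for constants 0 < c₁ ≤ c₂ < 1, the random variable (1−T)·Y₀/(1−τ) is integrable and E[(1−T)·Y₀/(1−τ)] = E[Y₀]. (This is the inverse probability weighting identity for the control group underlying the IPW estimator of μ₀.) -/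
open MeasureTheory ProbabilityTheory

section CondIndepFun

variable {Ω : Type*} {m mΩ : MeasurableSpace Ω} [StandardBorelSpace Ω] {hm : m ≤ mΩ}
  {μ : Measure Ω} [IsFiniteMeasure μ]

lemma ProbabilityTheory.CondIndepFun.congr_ae {β γ : Type*} [MeasurableSpace β]
    [MeasurableSpace γ] {f f' : Ω → β} {g g' : Ω → γ} (h : CondIndepFun m hm f g μ)
    (hf : f =ᵐ[μ] f') (hg : g =ᵐ[μ] g') : CondIndepFun m hm f' g' μ := by
  rw [← condExpKernel_comp_trim (μ := μ) hm] at hf hg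
  exact Kernel.IndepFun.congr' h (Measure.ae_ae_of_ae_comp hf) (Measure.ae_ae_of_ae_comp hg)

lemma ProbabilityTheory.CondIndepFun.ae_indepFun_condExpKernel_s11 {β γ : Type*}
    [MeasurableSpace β] [MeasurableSpace γ] [MeasurableSpace.CountablyGenerated (β × γ)]
    {f : Ω → β} {g : Ω → γ} (h : CondIndepFun m hm f g μ)
    (hf : Measurable f) (hg : Measurable g) :
    ∀ᵐ ω ∂μ, IndepFun f g (condExpKernel μ m ω) := by
  filter_upwards [ae_of_ae_trim hm ((condIndepFun_iff_map_prod_eq_prod_map_map hf hg).1 h)]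
    with ω hω
  rw [indepFun_iff_map_prod_eq_prod_map_map hf.aemeasurable hg.aemeasurable]
  rwa [Kernel.map_apply _ (hf.prodMk hg), Kernel.prod_apply, Kernel.map_apply _ hf,
    Kernel.map_apply _ hg] at hω

/-- The conditional expectation of a product of conditionally independent random variables is
the product of their conditional expectations. -/
lemma ProbabilityTheory.CondIndepFun.condExp_mul_s11 {f g : Ω → ℝ} (h : CondIndepFun m hm f g μ)
    (hf : Integrable f μ) (hg : Integrable g μ) (hfg : Integrable (f * g) μ) :
    μ[f * g | m] =ᵐ[μ] μ[f | m] * μ[g | m] := by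
  obtain ⟨f', hf'm, hff'⟩ := hf.aestronglyMeasurable
  obtain ⟨g', hg'm, hgg'⟩ := hg.aestronglyMeasurable
  have key : μ[f' * g' | m] =ᵐ[μ] μ[f' | m] * μ[g' | m] := by
    filter_upwards [(h.congr_ae hff' hgg').ae_indepFun_condExpKernel_s11 hf'm.measurable
        hg'm.measurable, condExp_ae_eq_integral_condExpKernel hm (hf.congr hff'),
      condExp_ae_eq_integral_condExpKernel hm (hg.congr hgg'),
      condExp_ae_eq_integral_condExpKernel hm (hfg.congr (hff'.mul hgg'))] with ω hi h₁ h₂ h₃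
    rw [Pi.mul_apply, h₁, h₂, h₃]
    exact hi.integral_mul_eq_mul_integral hf'm.aestronglyMeasurable hg'm.aestronglyMeasurable
  exact (condExp_congr_ae (hff'.mul hgg')).trans (key.trans
    ((condExp_congr_ae hff').symm.mul (condExp_congr_ae hgg').symm))

end CondIndepFun

/-- Inverse probability weighting identity for the control group: under SITA (`T` and `Y₀`
conditionally independent given `σ(X)`), with `τ` a `σ(X)`-measurable version of
`E[T | σ(X)]` bounded in `[c₁, c₂] ⊆ (0, 1)`, the random variable `(1-T)·Y₀/(1-τ)` is
integrable and `E[(1-T)·Y₀/(1-τ)] = E[Y₀]`. -/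
theorem ipw_identity_control {Ω : Type*} [mΩ : MeasurableSpace Ω]
    [StandardBorelSpace Ω] [Nonempty Ω]
    {E : Type*} [mE : MeasurableSpace E]
    (μ : Measure Ω) [IsProbabilityMeasure μ]
    (X : Ω → E) (hX : Measurable X)
    (T : Ω → ℝ) (hTmeas : Measurable T) (hT01 : ∀ ω, T ω = 0 ∨ T ω = 1)
    (Y0 : Ω → ℝ) (hY0 : Integrable Y0 μ)
    (hCI : CondIndepFun (mE.comap X) hX.comap_le T Y0 μ)
    (τ : Ω → ℝ) (hτmeas : Measurable[mE.comap X] τ)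
    (hτver : τ =ᵐ[μ] μ[T | mE.comap X])
    (c₁ c₂ : ℝ) (hc₁ : 0 < c₁) (hc₁₂ : c₁ ≤ c₂) (hc₂ : c₂ < 1)
    (hτbd : ∀ᵐ ω ∂μ, c₁ ≤ τ ω ∧ τ ω ≤ c₂) :
    Integrable (fun ω => (1 - T ω) * Y0 ω / (1 - τ ω)) μ ∧
    ∫ ω, (1 - T ω) * Y0 ω / (1 - τ ω) ∂μ = ∫ ω, Y0 ω ∂μ := by
  have hm : mE.comap X ≤ mΩ := hX.comap_le
  have hT : Integrable T μ := .of_bound hTmeas.aestronglyMeasurable 1 <| .of_forall fun ω => by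
    rcases hT01 ω with h | h <;> simp [h]
  have hS : Integrable (fun ω => 1 - T ω) μ := (integrable_const 1).sub hT
  have hSY : Integrable ((fun ω => 1 - T ω) * Y0) μ :=
    hY0.bdd_mul (c := 1) hS.aestronglyMeasurable <| .of_forall fun ω => by
      rcases hT01 ω with h | h <;> simp [h]
  have hw : StronglyMeasurable[mE.comap X] (fun ω => (1 - τ ω)⁻¹) :=
    (measurable_const.sub hτmeas).inv.stronglyMeasurable
  have hint : Integrable ((fun ω => (1 - τ ω)⁻¹) * ((fun ω => 1 - T ω) * Y0)) μ := by
    refine hSY.bdd_mul (c := (1 - c₂)⁻¹) (hw.mono hm).aestronglyMeasurable ?_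
    filter_upwards [hτbd] with ω hω
    rw [Real.norm_of_nonneg (inv_nonneg.2 (by linarith))]
    exact inv_anti₀ (by linarith) (by linarith)
  have hcS : μ[fun ω => 1 - T ω | mE.comap X] =ᵐ[μ] fun ω => 1 - τ ω := by
    filter_upwards [condExp_sub (integrable_const (1 : ℝ)) hT (mE.comap X), hτver] with ω h₁ h₂
    rw [h₂]
    exact h₁.trans (by simp [condExp_const hm])
  have hCI' : CondIndepFun (mE.comap X) hm (fun ω => 1 - T ω) Y0 μ :=
    hCI.comp (φ := fun t => 1 - t) (ψ := id) (by fun_prop) measurable_id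
  have heq : (fun ω => (1 - T ω) * Y0 ω / (1 - τ ω)) =
      (fun ω => (1 - τ ω)⁻¹) * ((fun ω => 1 - T ω) * Y0) := by
    ext ω
    simp only [Pi.mul_apply, div_eq_inv_mul]
  rw [heq]
  refine ⟨hint, ?_⟩
  rw [← integral_condExp hm, ← integral_condExp hm (f := Y0)]
  refine integral_congr_ae ?_
  filter_upwards [condExp_mul_of_stronglyMeasurable_left hw hint hSY,
    hCI'.condExp_mul_s11 hS hY0 hSY, hcS, hτbd] with ω h₁ h₂ h₃ h₄
  rw [h₁, Pi.mul_apply, h₂, Pi.mul_apply, h₃, inv_mul_cancel_left₀ (by linarith)]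
end

section
/- Under the SITA assumption that T and Y₁ are conditionally independent given σ(X), if m is a σ(X)-measurable integrable version of E[Y₁ | σ(X)] and τ is any σ(X)-measurable random variable satisfying c₁ ≤ τ ≤ c₂ almost surely (0 < c₁ ≤ c₂ < 1) — not necessarily equal to E[T | σ(X)] — then the random variable m + T·(Y₁ − m)/τ is integrable and E[m + T·(Y₁ − m)/τ] = E[Y₁]. (This is the augmented IPW identity when the outcome regression model is correctly specified, for an arbitrary — possibly misspecified — propensity score τ.) -/
open MeasureTheory ProbabilityTheory

/-- Conditionally independent functions are almost surely independent under the regular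
conditional probability. -/
theorem ProbabilityTheory.CondIndepFun.ae_indepFun_condExpKernel_s14 {Ω β β' : Type*} {m' mΩ : MeasurableSpace Ω}
    [StandardBorelSpace Ω] {hm' : m' ≤ mΩ} {μ : Measure Ω} [IsFiniteMeasure μ]
    {mβ : MeasurableSpace β} {mβ' : MeasurableSpace β'}
    [MeasurableSpace.CountableOrCountablyGenerated Ω (β × β')]
    {f : Ω → β} {g : Ω → β'} (hfg : CondIndepFun m' hm' f g μ)
    (hf : AEMeasurable f μ) (hg : AEMeasurable g μ) :
    ∀ᵐ ω ∂μ.trim hm', IndepFun f g (condExpKernel μ m' ω) := by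
  have hf' : ∀ᵐ ω ∂μ.trim hm', f =ᵐ[condExpKernel μ m' ω] hf.mk f := by
    refine Measure.ae_ae_of_ae_comp ?_
    rw [condExpKernel_comp_trim hm']
    exact hf.ae_eq_mk
  have hg' : ∀ᵐ ω ∂μ.trim hm', g =ᵐ[condExpKernel μ m' ω] hg.mk g := by
    refine Measure.ae_ae_of_ae_comp ?_
    rw [condExpKernel_comp_trim hm']
    exact hg.ae_eq_mk
  have hmk : CondIndepFun m' hm' (hf.mk f) (hg.mk g) μ := Kernel.IndepFun.congr' hfg hf' hg'
  rw [condIndepFun_iff_map_prod_eq_prod_map_map hf.measurable_mk hg.measurable_mk] at hmk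
  filter_upwards [hmk, hf', hg'] with ω hω hfω hgω
  rw [Kernel.map_apply _ (hf.measurable_mk.prodMk hg.measurable_mk), Kernel.prod_apply,
    Kernel.map_apply _ hf.measurable_mk, Kernel.map_apply _ hg.measurable_mk] at hω
  exact ((indepFun_iff_map_prod_eq_prod_map_map hf.measurable_mk.aemeasurable
    hg.measurable_mk.aemeasurable).2 hω).congr hfω.symm hgω.symm

/-- The conditional expectation of a product of conditionally independent functions is the product
of the conditional expectations. -/
theorem ProbabilityTheory.CondIndepFun.condExp_mul_s14 {Ω : Type*} {m' mΩ : MeasurableSpace Ω}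
    [StandardBorelSpace Ω] {hm' : m' ≤ mΩ} {μ : Measure Ω} [IsFiniteMeasure μ]
    {f g : Ω → ℝ} (hfg : CondIndepFun m' hm' f g μ)
    (hf : Integrable f μ) (hg : Integrable g μ) (hmul : Integrable (f * g) μ) :
    μ[f * g | m'] =ᵐ[μ] μ[f | m'] * μ[g | m'] := by
  filter_upwards [condExp_ae_eq_integral_condExpKernel hm' hmul,
    condExp_ae_eq_integral_condExpKernel hm' hf, condExp_ae_eq_integral_condExpKernel hm' hg,
    hf.condExpKernel_ae (m := m'), hg.condExpKernel_ae (m := m'),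
    ae_of_ae_trim hm' (hfg.ae_indepFun_condExpKernel_s14 hf.aemeasurable hg.aemeasurable)]
    with ω hω hfω hgω hfi hgi hind
  rw [Pi.mul_apply, hω, hfω, hgω]
  exact hind.integral_mul_eq_mul_integral hfi.aestronglyMeasurable hgi.aestronglyMeasurable

/-- Augmented IPW identity with a correctly specified outcome regression model: under SITA
(`T` and `Y₁` conditionally independent given `σ(X)`), if `m` is a `σ(X)`-measurable
integrable version of `E[Y₁ | σ(X)]` and `τ` is any `σ(X)`-measurable random variable
bounded in `[c₁, c₂] ⊆ (0, 1)` (a possibly misspecified propensity score), then the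
random variable `m + T·(Y₁ - m)/τ` is integrable and `E[m + T·(Y₁ - m)/τ] = E[Y₁]`. -/
theorem aipw_identity_correct_or {Ω : Type*} [mΩ : MeasurableSpace Ω]
    [StandardBorelSpace Ω] [Nonempty Ω]
    {E : Type*} [mE : MeasurableSpace E]
    (μ : Measure Ω) [IsProbabilityMeasure μ]
    (X : Ω → E) (hX : Measurable X)
    (T : Ω → ℝ) (hTmeas : Measurable T) (hT01 : ∀ ω, T ω = 0 ∨ T ω = 1)
    (Y1 : Ω → ℝ) (hY1 : Integrable Y1 μ)
    (hCI : CondIndepFun (mE.comap X) hX.comap_le T Y1 μ)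
    (m : Ω → ℝ) (hmmeas : Measurable[mE.comap X] m) (hmint : Integrable m μ)
    (hmver : m =ᵐ[μ] μ[Y1 | mE.comap X])
    (τ : Ω → ℝ) (hτmeas : Measurable[mE.comap X] τ)
    (c₁ c₂ : ℝ) (hc₁ : 0 < c₁) (hc₁₂ : c₁ ≤ c₂) (hc₂ : c₂ < 1)
    (hτbd : ∀ᵐ ω ∂μ, c₁ ≤ τ ω ∧ τ ω ≤ c₂) :
    Integrable (fun ω => m ω + T ω * (Y1 ω - m ω) / τ ω) μ ∧
    ∫ ω, (m ω + T ω * (Y1 ω - m ω) / τ ω) ∂μ = ∫ ω, Y1 ω ∂μ := by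
  have hG := hX.comap_le
  have hT_bound : ∀ᵐ ω ∂μ, ‖T ω‖ ≤ 1 :=
    .of_forall fun ω => by rcases hT01 ω with h | h <;> simp [h]
  have hTint : Integrable T μ := .of_bound hTmeas.aestronglyMeasurable 1 hT_bound
  have hTY : Integrable (T * Y1) μ := hY1.bdd_mul hTmeas.aestronglyMeasurable hT_bound
  have hTm : Integrable (T * m) μ := hmint.bdd_mul hTmeas.aestronglyMeasurable hT_bound
  have hres : Integrable (T * Y1 - T * m) μ := hTY.sub hTm
  have hinv_meas : StronglyMeasurable[mE.comap X] τ⁻¹ := hτmeas.inv.stronglyMeasurable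
  have hinv_bound : ∀ᵐ ω ∂μ, ‖τ⁻¹ ω‖ ≤ c₁⁻¹ := by
    filter_upwards [hτbd] with ω hω
    rw [Pi.inv_apply, norm_inv, Real.norm_of_nonneg (hc₁.le.trans hω.1)]
    exact inv_anti₀ hc₁ hω.1
  have hcorr : Integrable (τ⁻¹ * (T * Y1 - T * m)) μ :=
    hres.bdd_mul (hinv_meas.mono hG).aestronglyMeasurable hinv_bound
  have hres_zero : μ[T * Y1 - T * m | mE.comap X] =ᵐ[μ] 0 := by
    filter_upwards [condExp_sub hTY hTm (mE.comap X), hCI.condExp_mul_s14 hTint hY1 hTY,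
      condExp_mul_of_stronglyMeasurable_right hmmeas.stronglyMeasurable hTm hTint, hmver]
      with ω hsub hTYω hTmω hmω
    simp [hsub, hTYω, hTmω, hmω]
  have hcorr_zero : ∫ ω, (τ⁻¹ * (T * Y1 - T * m)) ω ∂μ = 0 := by
    rw [← integral_condExp hG]
    refine integral_eq_zero_of_ae ?_
    filter_upwards [condExp_mul_of_stronglyMeasurable_left hinv_meas hcorr hres, hres_zero]
      with ω hω hω0
    simp [hω, hω0]
  have hm_integral : ∫ ω, m ω ∂μ = ∫ ω, Y1 ω ∂μ := by
    rw [integral_congr_ae hmver, integral_condExp hG]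
  have heq : (fun ω => m ω + T ω * (Y1 ω - m ω) / τ ω)
      = fun ω => m ω + (τ⁻¹ * (T * Y1 - T * m)) ω := by
    ext ω
    simp only [Pi.mul_apply, Pi.sub_apply, Pi.inv_apply]
    ring
  rw [heq]
  exact ⟨hmint.add hcorr, by rw [integral_add hmint hcorr, hcorr_zero, hm_integral, add_zero]⟩
end
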